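/- If G is a minimal counterexample, then any two distinct vertices of G of degree 2 are at graph distance at least 4 from each other. -/

import Mathlib

open SimpleGraph

/-- A `(1,2^k)`-packing edge-coloring encoded as a function assigning a color in
`Fin (k+1)` to each unordered pair. Color `0` is the 1-color (its class must be a
matching) and each color `i ≠ 0` is a 2-color (its class must be an induced matching). -/
def IsPackingEC {V : Type} (G : SimpleGraph V) (k : ℕ)
    (c : Sym2 V → Fin (k + 1)) : Prop :=
  (∀ a b x y : V, G.Adj a b → G.Adj x y → s(a, b) ≠ s(x, y) →
      c s(a, b) = 0 → c s(x, y) = 0 →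
      a ≠ x ∧ a ≠ y ∧ b ≠ x ∧ b ≠ y) ∧
  ∀ a b x y : V, G.Adj a b → G.Adj x y → s(a, b) ≠ s(x, y) →
      c s(a, b) = c s(x, y) → c s(a, b) ≠ 0 →
      (a ≠ x ∧ a ≠ y ∧ b ≠ x ∧ b ≠ y) ∧
      ¬G.Adj a x ∧ ¬G.Adj a y ∧ ¬G.Adj b x ∧ ¬G.Adj b y

/-- A good coloring: a `(1,2^7)`-packing edge-coloring in which every edge of the
1-color class (color `0`) has both endpoints of degree 3. -/
def GoodColoring {V : Type} (G : SimpleGraph V) (c : Sym2 V → Fin 8) : Prop :=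
  IsPackingEC G 7 c ∧
  ∀ a b : V, G.Adj a b → c s(a, b) = 0 →
    (G.neighborSet a).ncard = 3 ∧ (G.neighborSet b).ncard = 3

/-- A graph is subcubic if every vertex has degree at most 3. -/
def Subcubic {V : Type} (G : SimpleGraph V) : Prop :=
  ∀ v : V, (G.neighborSet v).ncard ≤ 3

/-- A minimal counterexample: a finite subcubic simple graph with no good coloring such
that every finite subcubic simple graph with smaller `|V| + |E|` has a good coloring. -/
def MinCounter (V : Type) [Finite V] (G : SimpleGraph V) : Prop :=
  Subcubic G ∧
  (¬∃ c : Sym2 V → Fin 8, GoodColoring G c) ∧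
  ∀ (W : Type) [Finite W] (H : SimpleGraph W), Subcubic H →
    Nat.card W + H.edgeSet.ncard < Nat.card V + G.edgeSet.ncard →
    ∃ c : Sym2 W → Fin 8, GoodColoring H c

namespace PackingEC

variable {V : Type} {G : SimpleGraph V} {φ φ' : Sym2 V → Fin 8} {U : Set (Sym2 V)}

/-- Two edges conflict if they are distinct and share a vertex or are joined by an edge. -/
def Conflict (G : SimpleGraph V) (e f : Sym2 V) : Prop :=
  e ≠ f ∧ ∃ x ∈ e, ∃ y ∈ f, x = y ∨ G.Adj x y

/-- `φ` restricted to the edges outside `U` satisfies the constraints of a good coloring of `G`;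
edges in `U` count as not yet colored, and have an endpoint of degree other than 3. -/
structure PartialGood (G : SimpleGraph V) (U : Set (Sym2 V)) (φ : Sym2 V → Fin 8) : Prop where
  zero_degree : ∀ x y, G.Adj x y → φ s(x, y) = 0 →
    (G.neighborSet x).ncard = 3 ∧ (G.neighborSet y).ncard = 3
  zero_matching : ∀ x y z, G.Adj x y → G.Adj x z → φ s(x, y) = 0 → φ s(x, z) = 0 → y = z
  uncolored_degree : ∀ x y, s(x, y) ∈ U →
    (G.neighborSet x).ncard ≠ 3 ∨ (G.neighborSet y).ncard ≠ 3
  proper : ∀ e ∈ G.edgeSet, ∀ f ∈ G.edgeSet, e ∉ U → f ∉ U → Conflict G e f →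
    φ e ≠ 0 → φ e ≠ φ f

/-- The edges at `x`, other than `xy`, that are not assigned color `0`. -/
def nonzeroAt (G : SimpleGraph V) (φ : Sym2 V → Fin 8) (x y : V) : Set (Sym2 V) :=
  {f | ∃ z, G.Adj x z ∧ z ≠ y ∧ φ s(x, z) ≠ 0 ∧ f = s(x, z)}

/-- The edges not assigned color `0` that conflict with `xy` through the endpoint `x`. -/
def nonzeroSide (G : SimpleGraph V) (φ : Sym2 V → Fin 8) (x y : V) : Set (Sym2 V) :=
  nonzeroAt G φ x y ∪ {f | ∃ z, G.Adj x z ∧ z ≠ y ∧ f ∈ nonzeroAt G φ z x}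

/-- The edges not assigned color `0` that conflict with `e`. -/
def nonzeroConflict (G : SimpleGraph V) (φ : Sym2 V → Fin 8) (e : Sym2 V) : Set (Sym2 V) :=
  {f | f ∈ G.edgeSet ∧ φ f ≠ 0 ∧ Conflict G e f}

/-- The nonzero colors that can be given to `e`. -/
def available (G : SimpleGraph V) (U : Set (Sym2 V)) (φ : Sym2 V → Fin 8) (e : Sym2 V) :
    Set (Fin 8) :=
  {k | k ≠ 0 ∧ ∀ f ∈ G.edgeSet, f ∉ U → Conflict G e f → φ f ≠ k}

/-- Every edge of the list conflicts with at most six nonzero edges that do not come later. -/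
def GreedyOrder (G : SimpleGraph V) (φ : Sym2 V → Fin 8) : List (Sym2 V) → Prop
  | [] => True
  | e :: l => (nonzeroConflict G φ e \ {f | f ∈ l}).ncard ≤ 6 ∧ GreedyOrder G φ l

/-- Either few nonzero edges remain at `c` besides `cu`, or few remain at each of the other
neighbors of `c`. -/
def Relaxed (G : SimpleGraph V) (φ : Sym2 V → Fin 8) (c u : V) : Prop :=
  (nonzeroAt G φ c u).ncard ≤ 1 ∨
    ∀ x, G.Adj c x → x ≠ u → (nonzeroAt G φ x c).ncard ≤ 1

theorem Conflict.symm {e f : Sym2 V} (h : Conflict G e f) : Conflict G f e := by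
  obtain ⟨h1, x, hx, y, hy, h2⟩ := h
  exact ⟨h1.symm, y, hy, x, hx, h2.imp Eq.symm SimpleGraph.Adj.symm⟩

theorem PartialGood.goodColoring (h : PartialGood G ∅ φ) : GoodColoring G φ := by
  refine ⟨⟨fun a b x y hab hxy hne h0 h0' => ?_, fun a b x y hab hxy hne heq h0 => ?_⟩,
    h.zero_degree⟩
  · have key : ∀ a b x y, G.Adj a b → G.Adj x y → s(a, b) ≠ s(x, y) → φ s(a, b) = 0 →
        φ s(x, y) = 0 → a ≠ x := by
      rintro a b x y hab hxy hne h0 h0' rfl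
      exact hne (by rw [h.zero_matching a b y hab hxy h0 h0'])
    refine ⟨key a b x y hab hxy hne h0 h0',
      key a b y x hab hxy.symm (by rwa [Sym2.eq_swap (a := y)]) h0 (by rwa [Sym2.eq_swap]),
      key b a x y hab.symm hxy (by rwa [Sym2.eq_swap (a := b)]) (by rwa [Sym2.eq_swap]) h0',
      key b a y x hab.symm hxy.symm
        (by rwa [Sym2.eq_swap (a := b), Sym2.eq_swap (a := y)])
        (by rwa [Sym2.eq_swap]) (by rwa [Sym2.eq_swap])⟩
  · have key : ∀ p ∈ s(a, b), ∀ q ∈ s(x, y), ¬(p = q ∨ G.Adj p q) := fun p hp q hq hpq =>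
      h.proper _ hab _ hxy (Set.notMem_empty _) (Set.notMem_empty _)
        ⟨hne, p, hp, q, hq, hpq⟩ h0 heq
    have := key a (by simp) x (by simp)
    have := key a (by simp) y (by simp)
    have := key b (by simp) x (by simp)
    have := key b (by simp) y (by simp)
    tauto

theorem PartialGood.ne_zero_of_mem (h : PartialGood G U φ) {e : Sym2 V} (he : e ∈ G.edgeSet)
    (hU : e ∈ U) : φ e ≠ 0 := by
  induction e with
  | _ x y =>
    intro h0
    have := h.zero_degree x y he h0
    have := h.uncolored_degree x y hU
    tauto

/-- An edge between two vertices of degree 3 without edges of color `0` can be given color `0`. -/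
theorem PartialGood.recolor (h : PartialGood G U φ) {x y : V} (hxy : G.Adj x y)
    (hx : (G.neighborSet x).ncard = 3) (hy : (G.neighborSet y).ncard = 3)
    (hx0 : ∀ z, G.Adj x z → φ s(x, z) ≠ 0) (hy0 : ∀ z, G.Adj y z → φ s(y, z) ≠ 0) :
    ∃ φ', PartialGood G U φ' ∧ φ' s(x, y) = 0 ∧ ∀ e, e ≠ s(x, y) → φ' e = φ e := by
  classical
  refine ⟨Function.update φ s(x, y) 0, ⟨?_, ?_, h.uncolored_degree, ?_⟩, by simp,
    fun e he => by simp [he]⟩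
  · intro p q hpq h0
    by_cases he : s(p, q) = s(x, y)
    · grind
    · rw [Function.update_of_ne he] at h0
      exact h.zero_degree p q hpq h0
  · intro p q r hpq hpr h0 h1
    have hp : (p = x ∨ p = y) → ∀ w, G.Adj p w → φ s(p, w) ≠ 0 := by
      rintro (rfl | rfl)
      exacts [hx0, hy0]
    have hmem : ∀ w, s(p, w) = s(x, y) → p = x ∨ p = y := fun w hw =>
      Sym2.mem_iff.1 (hw ▸ Sym2.mem_mk_left p w)
    rw [Function.update_apply] at h0 h1
    split_ifs at h0 h1 with e1 e2 e2
    · exact Sym2.congr_right.1 (e1.trans e2.symm)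
    · exact absurd h1 (hp (hmem q e1) r hpr)
    · exact absurd h0 (hp (hmem r e2) q hpq)
    · exact h.zero_matching p q r hpq hpr h0 h1
  · intro e he f hf heU hfU hc h0
    have := h.proper e he f hf heU hfU hc
    simp only [Function.update_apply] at h0 ⊢
    grind

/-- An uncolored edge can be given any available color. -/
theorem PartialGood.extend (h : PartialGood G U φ) {e : Sym2 V} (he : e ∈ G.edgeSet)
    (hU : e ∈ U) {k : Fin 8} (hk : k ∈ available G U φ e) {φ' : Sym2 V → Fin 8}
    (h1 : φ' e = k) (h2 : ∀ f, f ≠ e → φ' f = φ f) :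
    PartialGood G (U \ {e}) φ' := by
  have h0 : ∀ f, φ' f = 0 → φ f = 0 := fun f hf => by
    by_cases hfe : f = e
    · exact absurd (h1.symm.trans (hfe ▸ hf)) hk.1
    · rwa [← h2 f hfe]
  refine ⟨fun x y hxy hz => h.zero_degree x y hxy (h0 _ hz),
    fun x y z hy hz h3 h4 => h.zero_matching x y z hy hz (h0 _ h3) (h0 _ h4),
    fun x y hxy => h.uncolored_degree x y hxy.1, fun f hf g hg hfU hgU hc hz => ?_⟩
  have hne := hc.1
  by_cases hfe : f = e
  · subst hfe
    rw [h1, h2 g hne.symm]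
    exact (hk.2 g hg (fun hg' => hgU ⟨hg', hne.symm⟩) hc).symm
  · rw [h2 f hfe] at hz ⊢
    have hfU' : f ∉ U := fun h' => hfU ⟨h', hfe⟩
    by_cases hge : g = e
    · subst hge
      rw [h1]
      exact hk.2 f hf hfU' hc.symm
    · rw [h2 g hge]
      exact h.proper f hf g hg hfU' (fun h' => hgU ⟨h', hge⟩) hc hz

theorem nonzeroConflict_congr (h : ∀ f, f ∈ G.edgeSet → (φ f = 0 ↔ φ' f = 0)) (e : Sym2 V) :
    nonzeroConflict G φ e = nonzeroConflict G φ' e := by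
  ext f
  simp only [nonzeroConflict, Set.mem_ofPred_eq]
  have := h f
  tauto

theorem GreedyOrder.congr (h : ∀ f, f ∈ G.edgeSet → (φ f = 0 ↔ φ' f = 0)) {l : List (Sym2 V)}
    (hl : GreedyOrder G φ l) : GreedyOrder G φ' l := by
  induction l with
  | nil => trivial
  | cons e l ih => exact ⟨nonzeroConflict_congr h e ▸ hl.1, ih hl.2⟩

theorem nonzeroConflict_subset {x y : V} :
    nonzeroConflict G φ s(x, y) ⊆ nonzeroSide G φ x y ∪ nonzeroSide G φ y x := by
  have key : ∀ x y p q, G.Adj p q → φ s(p, q) ≠ 0 → s(x, y) ≠ s(p, q) →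
      (x = p ∨ G.Adj x p) → s(p, q) ∈ nonzeroSide G φ x y ∪ nonzeroSide G φ y x := by
    intro x y p q hpq h0 hne hx
    rcases hx with rfl | hx
    · exact Or.inl (Or.inl ⟨q, hpq, by rintro rfl; exact hne rfl, h0, rfl⟩)
    · by_cases hpy : p = y
      · subst hpy
        exact Or.inr (Or.inl ⟨q, hpq, by rintro rfl; exact hne Sym2.eq_swap, h0, rfl⟩)
      · by_cases hqx : q = x
        · subst hqx
          exact Or.inl (Or.inl ⟨p, hx, hpy, by rwa [Sym2.eq_swap], Sym2.eq_swap⟩)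
        · exact Or.inl (Or.inr ⟨p, hx, hpy, q, hpq, hqx, h0, rfl⟩)
  rintro f ⟨hf, h0, hne, α, hα, β, hβ, hc⟩
  obtain ⟨q, rfl⟩ := hβ
  rcases Sym2.mem_iff.1 hα with rfl | rfl
  · exact key _ _ _ _ hf h0 hne hc
  · exact (key _ _ _ _ hf h0 (by rwa [Sym2.eq_swap]) hc).symm

/-- Conflicts of an edge at a vertex `u` whose only neighbors are `a` and `c`. -/
theorem nonzeroConflict_subset_of_neighbors {u a c : V} (hu : ∀ x, G.Adj u x ↔ x = a ∨ x = c) :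
    nonzeroConflict G φ s(u, c) ⊆ nonzeroSide G φ c u ∪ insert s(u, a) (nonzeroAt G φ a u) := by
  intro f hf
  rcases nonzeroConflict_subset hf with (⟨z, h1, h2, h3, rfl⟩ | ⟨z, h1, h2, h3⟩) | h
  · obtain rfl := ((hu z).1 h1).resolve_right h2
    exact Or.inr (Or.inl rfl)
  · obtain rfl := ((hu z).1 h1).resolve_right h2
    exact Or.inr (Or.inr h3)
  · exact Or.inl h

theorem nonzeroAt_mono (h : ∀ e, φ e = 0 → φ' e = 0) (x y : V) :
    nonzeroAt G φ' x y ⊆ nonzeroAt G φ x y := by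
  rintro f ⟨z, h1, h2, h3, rfl⟩
  exact ⟨z, h1, h2, fun h0 => h3 (h _ h0), rfl⟩

theorem nonzeroSide_mono (h : ∀ e, φ e = 0 → φ' e = 0) (x y : V) :
    nonzeroSide G φ' x y ⊆ nonzeroSide G φ x y := by
  rintro f (hf | ⟨z, h1, h2, h3⟩)
  · exact Or.inl (nonzeroAt_mono h _ _ hf)
  · exact Or.inr ⟨z, h1, h2, nonzeroAt_mono h _ _ h3⟩

theorem nonzeroAt_eq_image (x y : V) :
    nonzeroAt G φ x y =
      (fun z => s(x, z)) '' {z | z ∈ G.neighborSet x \ {y} ∧ φ s(x, z) ≠ 0} := by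
  ext f
  simp only [nonzeroAt, Set.mem_ofPred_eq, Set.mem_image, Set.mem_sdiff, mem_neighborSet,
    Set.mem_singleton_iff]
  constructor
  · rintro ⟨z, h1, h2, h3, rfl⟩
    exact ⟨z, ⟨⟨h1, h2⟩, h3⟩, rfl⟩
  · rintro ⟨z, ⟨⟨h1, h2⟩, h3⟩, rfl⟩
    exact ⟨z, h1, h2, h3, rfl⟩

theorem exists_neighbor_of_ncard_two {u a : V} (hu : (G.neighborSet u).ncard = 2)
    (hua : G.Adj u a) : ∃ c, c ≠ a ∧ ∀ x, G.Adj u x ↔ x = a ∨ x = c := by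
  obtain ⟨p, q, hpq, hs⟩ := Set.ncard_eq_two.1 hu
  have hmem : ∀ x, G.Adj u x ↔ x = p ∨ x = q := fun x => by
    rw [← SimpleGraph.mem_neighborSet, hs]
    rfl
  rcases (hmem a).1 hua with rfl | rfl
  · exact ⟨q, hpq.symm, hmem⟩
  · exact ⟨p, hpq, fun x => (hmem x).trans or_comm⟩

theorem exists_neighbor_of_ncard_three {a u b : V} (ha : (G.neighborSet a).ncard = 3)
    (hau : G.Adj a u) (hab : G.Adj a b) (hub : u ≠ b) :
    ∃ z, z ≠ u ∧ z ≠ b ∧ ∀ x, G.Adj a x ↔ x = u ∨ x = b ∨ x = z := by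
  obtain ⟨p, q, r, h1, h2, h3, hs⟩ := Set.ncard_eq_three.1 ha
  have hmem : ∀ x, G.Adj a x ↔ x = p ∨ x = q ∨ x = r := fun x => by
    rw [← SimpleGraph.mem_neighborSet, hs]
    rfl
  have hu := (hmem u).1 hau
  have hb := (hmem b).1 hab
  simp only [hmem]
  rcases hu with rfl | rfl | rfl <;> rcases hb with rfl | rfl | rfl
  any_goals exact absurd rfl hub
  exacts [⟨r, by grind⟩, ⟨q, by grind⟩, ⟨r, by grind⟩, ⟨p, by grind⟩, ⟨q, by grind⟩,
    ⟨p, by grind⟩]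

theorem ncard_setOf_mem_le {α : Type*} (l : List α) : {f | f ∈ l}.ncard ≤ l.length := by
  classical
  have : {f | f ∈ l} = (l.toFinset : Set α) := by
    ext
    simp
  rw [this, Set.ncard_coe_finset]
  exact l.toFinset_card_le

theorem incident_iff {u v a b c d : V} (hu : ∀ x, G.Adj u x ↔ x = a ∨ x = c)
    (hv : ∀ x, G.Adj v x ↔ x = b ∨ x = d) (e : Sym2 V) :
    e ∈ G.edgeSet ∧ (u ∈ e ∨ v ∈ e) ↔
      e = s(u, a) ∨ e = s(u, c) ∨ e = s(v, b) ∨ e = s(v, d) := by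
  constructor
  · rintro ⟨he, ⟨z, rfl⟩ | ⟨z, rfl⟩⟩
    · rcases (hu z).1 he with rfl | rfl <;> simp
    · rcases (hv z).1 he with rfl | rfl <;> simp
  · rintro (rfl | rfl | rfl | rfl)
    · exact ⟨(hu a).2 (Or.inl rfl), by simp⟩
    · exact ⟨(hu c).2 (Or.inr rfl), by simp⟩
    · exact ⟨(hv b).2 (Or.inl rfl), by simp⟩
    · exact ⟨(hv d).2 (Or.inr rfl), by simp⟩

/-- Hall's condition for four lists of sizes 2, 2, 3, 3, where the representatives of the first
two lists may coincide. -/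
theorem exists_representatives {α : Type*} [Finite α] {X Y P Q : Set α} (hX : 2 ≤ X.ncard)
    (hY : 2 ≤ Y.ncard) (hP : 3 ≤ P.ncard) (hQ : 3 ≤ Q.ncard) :
    ∃ x ∈ X, ∃ y ∈ Y, ∃ q ∈ Q, ∃ p ∈ P, q ≠ x ∧ q ≠ y ∧ p ≠ x ∧ p ≠ y ∧ p ≠ q := by
  have pick : ∀ (S : Set α) (l : List α), l.length < S.ncard → ∃ s ∈ S, s ∉ l := fun S l hl =>
    Set.exists_mem_notMem_of_ncard_lt_ncard ((ncard_setOf_mem_le l).trans_lt hl)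
  by_cases hXY : ∃ x, x ∈ X ∧ x ∈ Y
  · obtain ⟨x, hxX, hxY⟩ := hXY
    obtain ⟨q, hq, hq'⟩ := pick Q [x] (by simp; omega)
    obtain ⟨p, hp, hp'⟩ := pick P [x, q] (by simp; omega)
    exact ⟨x, hxX, x, hxY, q, hq, p, hp, by grind⟩
  have hdisj : Disjoint X Y := Set.disjoint_left.2 fun x h1 h2 => hXY ⟨x, h1, h2⟩
  obtain ⟨x, hx, -⟩ := pick X [] (by simp; omega)
  obtain ⟨y, hy, -⟩ := pick Y [] (by simp; omega)
  by_cases hP4 : 4 ≤ P.ncard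
  · obtain ⟨q, hq, hq'⟩ := pick Q [x, y] (by simp; omega)
    obtain ⟨p, hp, hp'⟩ := pick P [x, y, q] (by simp; omega)
    exact ⟨x, hx, y, hy, q, hq, p, hp, by grind⟩
  have hunion := Set.ncard_union_eq hdisj
  obtain ⟨z, hz, hzP⟩ := Set.exists_mem_notMem_of_ncard_lt_ncard
    (show P.ncard < (X ∪ Y).ncard by omega)
  rcases hz with hz | hz
  · obtain ⟨q, hq, hq'⟩ := pick Q [z, y] (by simp; omega)
    obtain ⟨p, hp, hp'⟩ := pick P [y, q] (by simp; omega)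
    exact ⟨z, hz, y, hy, q, hq, p, hp, by grind⟩
  · obtain ⟨q, hq, hq'⟩ := pick Q [x, z] (by simp; omega)
    obtain ⟨p, hp, hp'⟩ := pick P [x, q] (by simp; omega)
    exact ⟨x, hx, z, hz, q, hq, p, hp, by grind⟩

theorem PartialGood.exists_goodColoring_of_representatives {e₁ e₂ e₃ e₄ : Sym2 V}
    (hE : ∀ e ∈ [e₁, e₂, e₃, e₄], e ∈ G.edgeSet) (hnd : [e₁, e₂, e₃, e₄].Nodup)
    (hU : ∀ e, e ∈ U ↔ e ∈ [e₁, e₂, e₃, e₄]) (h : PartialGood G U φ)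
    (hc : ¬Conflict G e₁ e₂) (h₁ : 2 ≤ (available G U φ e₁).ncard)
    (h₂ : 2 ≤ (available G U φ e₂).ncard) (h₃ : 3 ≤ (available G U φ e₃).ncard)
    (h₄ : 3 ≤ (available G U φ e₄).ncard) : ∃ c, GoodColoring G c := by
  classical
  obtain ⟨x, hx, y, hy, q, hq, p, hp, hqx, hqy, hpx, hpy, hpq⟩ :=
    exists_representatives h₁ h₂ h₄ h₃
  have hc' : ¬Conflict G e₂ e₁ := fun h => hc h.symm
  simp only [List.nodup_cons, List.mem_cons, List.not_mem_nil, or_false, not_or, List.nodup_nil,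
    not_false_eq_true, and_true] at hnd hE hU
  obtain ⟨⟨h12, h13, h14⟩, ⟨h23, h24⟩, h34⟩ := hnd
  have g₁ := h.extend (φ' := Function.update φ e₁ x) (hE _ (by simp)) ((hU _).2 (by simp)) hx
    (by simp) (fun f hf => by simp [hf])
  have g₂ := g₁.extend (e := e₂) (k := y)
    (φ' := Function.update (Function.update φ e₁ x) e₂ y) (hE _ (by simp))
    ⟨(hU _).2 (by simp), Ne.symm h12⟩
    ⟨hy.1, fun f hf hfU hcf => by
      have hf1 : f ≠ e₁ := by rintro rfl; exact hc' hcf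
      rw [Function.update_of_ne hf1]
      exact hy.2 f hf (fun h => hfU ⟨h, hf1⟩) hcf⟩
    (by simp) (fun f hf => by simp [hf])
  have g₃ := g₂.extend (e := e₃) (k := q)
    (φ' := Function.update (Function.update (Function.update φ e₁ x) e₂ y) e₃ q)
    (hE _ (by simp)) ⟨⟨(hU _).2 (by simp), Ne.symm h13⟩, Ne.symm h23⟩
    ⟨hq.1, fun f hf hfU hcf => by
      by_cases hf2 : f = e₂
      · subst hf2; simpa using hqy.symm
      by_cases hf1 : f = e₁
      · subst hf1; simpa [h12] using hqx.symm
      simpa [hf1, hf2] using hq.2 f hf (fun h => hfU ⟨⟨h, hf1⟩, hf2⟩) hcf⟩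
    (by simp) (fun f hf => by simp [hf])
  have g₄ := g₃.extend (e := e₄) (k := p)
    (φ' := Function.update (Function.update (Function.update (Function.update φ e₁ x) e₂ y) e₃ q)
      e₄ p)
    (hE _ (by simp)) ⟨⟨⟨(hU _).2 (by simp), Ne.symm h14⟩, Ne.symm h24⟩, Ne.symm h34⟩
    ⟨hp.1, fun f hf hfU hcf => by
      by_cases hf3 : f = e₃
      · subst hf3; simpa using hpq.symm
      by_cases hf2 : f = e₂
      · subst hf2; simpa [h23] using hpy.symm
      by_cases hf1 : f = e₁
      · subst hf1; simpa [h12, h13] using hpx.symm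
      simpa [hf1, hf2, hf3] using hp.2 f hf (fun h => hfU ⟨⟨⟨h, hf1⟩, hf2⟩, hf3⟩) hcf⟩
    (by simp) (fun f hf => by simp [hf])
  have hempty : (((U \ {e₁}) \ {e₂}) \ {e₃}) \ {e₄} = ∅ := by
    ext f
    have := hU f
    simp only [Set.mem_sdiff, Set.mem_singleton_iff, Set.mem_empty_iff_false]
    tauto
  exact ⟨_, (hempty ▸ g₄).goodColoring⟩

theorem nonzeroAt_subset_of_two {u a c : V} (hu : ∀ x, G.Adj u x ↔ x = a ∨ x = c) :
    nonzeroAt G φ u a ⊆ {s(u, c)} := by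
  rintro f ⟨z, h1, h2, -, rfl⟩
  rw [((hu z).1 h1).resolve_left h2]
  rfl

theorem eq_or_eq_of_mem_nonzeroAt {a u b z : V} (ha : ∀ x, G.Adj a x ↔ x = u ∨ x = b ∨ x = z)
    {f : Sym2 V} (hf : f ∈ nonzeroAt G φ a u) : (f = s(a, b) ∨ f = s(a, z)) ∧ φ f ≠ 0 := by
  obtain ⟨x, h1, h2, h3, rfl⟩ := hf
  refine ⟨?_, h3⟩
  rcases ((ha x).1 h1).resolve_left h2 with rfl | rfl <;> simp

theorem mem_nonzeroSide_cases {a u b z : V} (ha : ∀ x, G.Adj a x ↔ x = u ∨ x = b ∨ x = z)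
    {f : Sym2 V} (hf : f ∈ nonzeroSide G φ a u) :
    f ∈ nonzeroAt G φ a u ∨ f ∈ nonzeroAt G φ b a ∨ f ∈ nonzeroAt G φ z a := by
  rcases hf with hf | ⟨x, h1, h2, hf⟩
  · exact Or.inl hf
  · rcases ((ha x).1 h1).resolve_left h2 with rfl | rfl <;> simp [hf]

section Finite

variable [Finite V]

theorem le_ncard_available {e : Sym2 V} {n : ℕ} (h : (nonzeroConflict G φ e \ U).ncard ≤ n) :
    7 ≤ (available G U φ e).ncard + n := by
  have hsub : (insert 0 (φ '' (nonzeroConflict G φ e \ U)))ᶜ ⊆ available G U φ e := by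
    intro k hk
    simp only [Set.mem_compl_iff, Set.mem_insert_iff, not_or] at hk
    refine ⟨hk.1, fun f hf hfU hc hfk => hk.2 ⟨f, ⟨⟨hf, ?_, hc⟩, hfU⟩, hfk⟩⟩
    rw [hfk]
    exact hk.1
  have h1 := Set.ncard_le_ncard hsub
  have h2 := Set.ncard_add_ncard_compl (insert 0 (φ '' (nonzeroConflict G φ e \ U)))
  have h3 := Set.ncard_insert_le 0 (φ '' (nonzeroConflict G φ e \ U))
  have h4 := Set.ncard_image_le (f := φ) (Set.toFinite (nonzeroConflict G φ e \ U))
  rw [Nat.card_fin] at h2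
  omega

/-- Uncolored edges listed in a greedy order can be colored one after the other. -/
theorem PartialGood.exists_goodColoring {l : List (Sym2 V)} (hl : ∀ e ∈ l, e ∈ G.edgeSet)
    (h : PartialGood G {e | e ∈ l} φ) (hg : GreedyOrder G φ l) : ∃ c, GoodColoring G c := by
  classical
  induction l generalizing φ with
  | nil => exact ⟨φ, PartialGood.goodColoring (by simpa using h)⟩
  | cons e l ih =>
    have hl' : ∀ e ∈ l, e ∈ G.edgeSet := fun f hf => hl f (List.mem_cons_of_mem _ hf)
    by_cases hel : e ∈ l
    · have : {f | f ∈ e :: l} = {f | f ∈ l} := by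
        ext f
        simp only [Set.mem_ofPred_eq, List.mem_cons]
        grind
      exact ih hl' (this ▸ h) hg.2
    · have hE := hl e (by simp)
      have hU : e ∈ {f | f ∈ e :: l} := by simp
      have hcard : (nonzeroConflict G φ e \ {f | f ∈ e :: l}).ncard ≤ 6 :=
        (Set.ncard_le_ncard (Set.sdiff_subset_sdiff_right
          (fun f hf => List.mem_cons_of_mem _ hf))).trans hg.1
      have hpos := le_ncard_available hcard
      obtain ⟨k, hk⟩ := (Set.ncard_pos (s := available G {f | f ∈ e :: l} φ e)).1 (by omega)
      have h' := h.extend (φ' := Function.update φ e k) hE hU hk (by simp)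
        (fun f hf => by simp [hf])
      have hset : {f | f ∈ e :: l} \ {e} = {f | f ∈ l} := by
        ext f
        simp only [Set.mem_sdiff, Set.mem_ofPred_eq, List.mem_cons, Set.mem_singleton_iff]
        grind
      refine ih hl' (hset ▸ h') (hg.2.congr fun f _ => ?_)
      by_cases hfe : f = e
      · subst hfe
        simp [h.ne_zero_of_mem hE hU, hk.1]
      · simp [hfe]

theorem Relaxed.mono (h : ∀ e, φ e = 0 → φ' e = 0) {c u : V} (hr : Relaxed G φ c u) :
    Relaxed G φ' c u :=
  hr.imp ((Set.ncard_le_ncard (nonzeroAt_mono h _ _)).trans ·) fun h' x h1 h2 =>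
    (Set.ncard_le_ncard (nonzeroAt_mono h _ _)).trans (h' x h1 h2)

theorem ncard_nonzeroAt_add_one_le {x y : V} (hxy : G.Adj x y) :
    (nonzeroAt G φ x y).ncard + 1 ≤ (G.neighborSet x).ncard := by
  rw [nonzeroAt_eq_image]
  have h1 := Set.ncard_image_le (f := fun z => s(x, z))
    (Set.toFinite {z | z ∈ G.neighborSet x \ {y} ∧ φ s(x, z) ≠ 0})
  have h2 : {z | z ∈ G.neighborSet x \ {y} ∧ φ s(x, z) ≠ 0}.ncard ≤
      (G.neighborSet x \ {y}).ncard := Set.ncard_le_ncard fun z hz => hz.1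
  have h3 := Set.ncard_sdiff_singleton_add_one (s := G.neighborSet x) (a := y) hxy
  omega

theorem ncard_nonzeroAt_add_two_le {x y z : V} (hxy : G.Adj x y) (hxz : G.Adj x z) (hzy : z ≠ y)
    (h0 : φ s(x, z) = 0) : (nonzeroAt G φ x y).ncard + 2 ≤ (G.neighborSet x).ncard := by
  rw [nonzeroAt_eq_image]
  have h1 := Set.ncard_image_le (f := fun z => s(x, z))
    (Set.toFinite {z | z ∈ G.neighborSet x \ {y} ∧ φ s(x, z) ≠ 0})
  have h2 : {w | w ∈ G.neighborSet x \ {y} ∧ φ s(x, w) ≠ 0}.ncard ≤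
      ((G.neighborSet x \ {y}) \ {z}).ncard :=
    Set.ncard_le_ncard fun w hw => ⟨hw.1, by rintro rfl; exact hw.2 h0⟩
  have h3 := Set.ncard_sdiff_singleton_add_one (s := G.neighborSet x) (a := y) hxy
  have h4 := Set.ncard_sdiff_singleton_add_one (s := G.neighborSet x \ {y}) (a := z) ⟨hxz, hzy⟩
  omega

theorem ncard_nonzeroAt_le (hG : Subcubic G) {x y : V} (hxy : G.Adj x y) :
    (nonzeroAt G φ x y).ncard ≤ 2 := by
  have := ncard_nonzeroAt_add_one_le (φ := φ) hxy
  have := hG x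
  omega

/-- A vertex with two nonzero edges besides `xy` has degree 3 and no other edge of color `0`. -/
theorem free_of_two_le (hG : Subcubic G) {x y : V} (hxy : G.Adj x y)
    (h : 1 < (nonzeroAt G φ x y).ncard) :
    (G.neighborSet x).ncard = 3 ∧ ∀ z, G.Adj x z → z ≠ y → φ s(x, z) ≠ 0 := by
  have h1 := ncard_nonzeroAt_add_one_le (φ := φ) hxy
  have h2 := hG x
  refine ⟨by omega, fun z hz hzy h0 => ?_⟩
  have := ncard_nonzeroAt_add_two_le hxy hz hzy h0
  omega

theorem ncard_nonzeroSide_le {x y : V} (hxy : G.Adj x y) {m : ℕ}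
    (hm : ∀ z, G.Adj x z → z ≠ y → (nonzeroAt G φ z x).ncard ≤ m) :
    (nonzeroSide G φ x y).ncard ≤ (nonzeroAt G φ x y).ncard +
      ((G.neighborSet x).ncard - 1) * m := by
  refine (Set.ncard_union_le _ _).trans (Nat.add_le_add_left ?_ _)
  have h3 := Set.ncard_sdiff_singleton_add_one (s := G.neighborSet x) (a := y) hxy
  have hc : (G.neighborSet x).ncard - 1 = (G.neighborSet x \ {y}).ncard := by omega
  have hset : {f | ∃ z, G.Adj x z ∧ z ≠ y ∧ f ∈ nonzeroAt G φ z x} =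
      ⋃ z ∈ (Set.toFinite (G.neighborSet x \ {y})).toFinset, nonzeroAt G φ z x := by
    ext f
    simp [and_assoc]
  rw [hc, hset, Set.ncard_eq_toFinset_card _ (Set.toFinite (G.neighborSet x \ {y}))]
  refine (Finset.set_ncard_biUnion_le _ _).trans (Finset.sum_le_card_nsmul _ _ _ fun z hz => ?_)
  rw [Set.Finite.mem_toFinset] at hz
  exact hm z hz.1 hz.2

/-- The two cases of `Relaxed`, in terms of the counts they provide. -/
theorem Relaxed.ncard_le (hG : Subcubic G) {c u : V} (hcu : G.Adj c u) (h : Relaxed G φ c u) :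
    ((nonzeroAt G φ c u).ncard ≤ 1 ∧ (nonzeroSide G φ c u).ncard ≤ 5) ∨
      ((nonzeroAt G φ c u).ncard ≤ 2 ∧ (nonzeroSide G φ c u).ncard ≤ 4) := by
  have h3 := hG c
  rcases h with h | h
  · have := ncard_nonzeroSide_le hcu (m := 2) (φ := φ)
      fun z hz _ => ncard_nonzeroAt_le hG hz.symm
    left; omega
  · have := ncard_nonzeroSide_le hcu (m := 1) (φ := φ) h
    have := ncard_nonzeroAt_le (φ := φ) hG hcu
    right; omega

/-- Recoloring at most one edge with color `0` makes `c` relaxed. -/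
theorem PartialGood.exists_relaxed (h : PartialGood G U φ) (hG : Subcubic G) {c u : V}
    (hcu : G.Adj c u) (hu : (G.neighborSet u).ncard ≠ 3) :
    ∃ φ', PartialGood G U φ' ∧ (∀ e, φ e = 0 → φ' e = 0) ∧ Relaxed G φ' c u := by
  by_cases hr : Relaxed G φ c u
  · exact ⟨φ, h, fun _ => id, hr⟩
  simp only [Relaxed, not_or, not_le, not_forall] at hr
  obtain ⟨h1, x, hcx, hxu, h2⟩ := hr
  obtain ⟨hc3, hc0⟩ := free_of_two_le hG hcu h1
  obtain ⟨hx3, hx0⟩ := free_of_two_le hG hcx.symm h2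
  obtain ⟨φ', h', h0, hext⟩ := h.recolor hcx hc3 hx3
    (fun z hz hz0 => by
      by_cases hzu : z = u
      · exact hu (hzu ▸ (h.zero_degree c z hz hz0).2)
      · exact hc0 z hz hzu hz0)
    (fun z hz hz0 => by
      by_cases hzc : z = c
      · subst hzc
        exact hc0 x hcx hxu (by rwa [Sym2.eq_swap])
      · exact hx0 z hz hzc hz0)
  refine ⟨φ', h', fun e he => ?_, Or.inl ?_⟩
  · by_cases hex : e = s(c, x)
    · rw [hex, h0]
    · rw [hext e hex, he]
  · have := ncard_nonzeroAt_add_two_le (φ := φ') hcu hcx hxu h0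
    omega

/-- Deleting all edges at `u` and `v` from a minimal counterexample leaves a graph with a good
coloring, in which no edge at a neighbor of `u` or `v` has color `0`. -/
theorem exists_partialGood (hG : MinCounter V G) {u v a : V} (hu : (G.neighborSet u).ncard = 2)
    (hv : (G.neighborSet v).ncard = 2) (hua : G.Adj u a) :
    ∃ φ, PartialGood G {e | e ∈ G.edgeSet ∧ (u ∈ e ∨ v ∈ e)} φ ∧
      ∀ w, w = u ∨ w = v → ∀ x, G.Adj w x → ∀ y, G.Adj x y → φ s(x, y) ≠ 0 := by
  classical
  obtain ⟨hsub, -, hmin⟩ := hG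
  let H : SimpleGraph V :=
    { Adj := fun x y => G.Adj x y ∧ x ≠ u ∧ x ≠ v ∧ y ≠ u ∧ y ≠ v
      symm := ⟨fun x y h => ⟨h.1.symm, h.2.2.2.1, h.2.2.2.2, h.2.1, h.2.2.1⟩⟩
      loopless := ⟨fun x h => G.irrefl h.1⟩ }
  have hH : ∀ x y, H.Adj x y ↔ G.Adj x y ∧ x ≠ u ∧ x ≠ v ∧ y ≠ u ∧ y ≠ v := fun x y => Iff.rfl
  have hle : ∀ x, H.neighborSet x ⊆ G.neighborSet x := fun x y h => ((hH x y).1 h).1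
  have hcard : H.edgeSet.ncard < G.edgeSet.ncard := by
    refine Set.ncard_lt_ncard ⟨SimpleGraph.edgeSet_mono fun x y h => ((hH x y).1 h).1, ?_⟩
    intro h
    have : H.Adj u a := h (show s(u, a) ∈ G.edgeSet from hua)
    exact ((hH u a).1 this).2.1 rfl
  obtain ⟨c, hc, hdeg⟩ := hmin V H (fun x => (Set.ncard_le_ncard (hle x)).trans (hsub x))
    (by omega)
  have hz : ∀ x y, G.Adj x y → (if u ∈ s(x, y) ∨ v ∈ s(x, y) then 1 else c s(x, y)) = 0 →
      H.Adj x y ∧ c s(x, y) = 0 := by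
    intro x y hxy h
    split_ifs at h with h'
    · exact absurd h (by decide)
    · simp only [Sym2.mem_iff, not_or] at h'
      exact ⟨(hH x y).2 ⟨hxy, Ne.symm h'.1.1, Ne.symm h'.2.1, Ne.symm h'.1.2, Ne.symm h'.2.2⟩, h⟩
  refine ⟨fun e => if u ∈ e ∨ v ∈ e then 1 else c e, ⟨?_, ?_, ?_, ?_⟩, ?_⟩
  · intro x y hxy h
    obtain ⟨h1, h2⟩ := hz x y hxy h
    have h3 := hdeg x y h1 h2
    have hx := Set.ncard_le_ncard (hle x)
    have hy := Set.ncard_le_ncard (hle y)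
    have hx' := hsub x
    have hy' := hsub y
    omega
  · intro x y z hxy hxz h h'
    obtain ⟨h1, h2⟩ := hz x y hxy h
    obtain ⟨h3, h4⟩ := hz x z hxz h'
    by_contra hyz
    exact (hc.1 x y x z h1 h3 (fun he => hyz (Sym2.congr_right.1 he)) h2 h4).1 rfl
  · rintro x y ⟨-, h⟩
    simp only [Sym2.mem_iff] at h
    rcases h with (rfl | rfl) | (rfl | rfl) <;> omega
  · intro e he f hf heU hfU hconf h0
    have heU' : ¬(u ∈ e ∨ v ∈ e) := fun h => heU ⟨he, h⟩
    have hfU' : ¬(u ∈ f ∨ v ∈ f) := fun h => hfU ⟨hf, h⟩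
    simp only [heU', hfU', if_false] at h0 ⊢
    intro heq
    obtain ⟨hne, x, hx, y, hy, hxy⟩ := hconf
    obtain ⟨x', rfl⟩ := hx
    obtain ⟨y', rfl⟩ := hy
    simp only [Sym2.mem_iff, not_or] at heU' hfU'
    have he' : H.Adj x x' := (hH _ _).2 ⟨he, by grind⟩
    have hf' : H.Adj y y' := (hH _ _).2 ⟨hf, by grind⟩
    have := hc.2 x x' y y' he' hf' hne heq h0
    rcases hxy with hxy | hxy
    · exact this.1.1 hxy
    · exact this.2.1 ((hH _ _).2 ⟨hxy, by grind⟩)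
  · intro w hw x hwx y hxy h
    obtain ⟨h1, h2⟩ := hz x y hxy h
    have h3 := (hdeg x y h1 h2).1
    have h4 : H.neighborSet x ⊆ G.neighborSet x \ {w} := fun z hz' => by
      have := (hH x z).1 hz'
      refine ⟨this.1, ?_⟩
      rintro rfl
      rcases hw with rfl | rfl
      · exact this.2.2.2.1 rfl
      · exact this.2.2.2.2 rfl
    have h5 := Set.ncard_le_ncard h4
    have h6 := Set.ncard_sdiff_singleton_add_one (s := G.neighborSet x) (a := w) hwx.symm
    have := hsub x
    omega

theorem ncard_diff_le {α : Type*} [Finite α] {N D : Set α} {m l : List α} (m' : List α)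
    (h : ∀ f ∈ N, f ∈ D ∨ f ∈ m) (hm : ∀ f ∈ m, f ∈ l ∨ f ∈ m') :
    (N \ {f | f ∈ l}).ncard ≤ D.ncard + m'.length := by
  have hsub : N \ {f | f ∈ l} ⊆ D ∪ {f | f ∈ m'} := by
    rintro f ⟨hf, hfl⟩
    exact (h f hf).imp id fun hfm => (hm f hfm).resolve_left hfl
  exact (Set.ncard_le_ncard hsub).trans <| (Set.ncard_union_le _ _).trans <|
    Nat.add_le_add_left (ncard_setOf_mem_le m') _

theorem PartialGood.exists_goodColoring_of_incident {u v a b c d : V}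
    (h : PartialGood G {e | e ∈ G.edgeSet ∧ (u ∈ e ∨ v ∈ e)} φ)
    (hu : ∀ x, G.Adj u x ↔ x = a ∨ x = c) (hv : ∀ x, G.Adj v x ↔ x = b ∨ x = d)
    {l : List (Sym2 V)}
    (hl : ∀ e, e ∈ l ↔ e = s(u, a) ∨ e = s(u, c) ∨ e = s(v, b) ∨ e = s(v, d))
    (hg : GreedyOrder G φ l) : ∃ c, GoodColoring G c := by
  have hmem : ∀ e, e ∈ l ↔ e ∈ G.edgeSet ∧ (u ∈ e ∨ v ∈ e) := fun e =>
    (hl e).trans (incident_iff hu hv e).symm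
  refine PartialGood.exists_goodColoring (fun e he => ((hmem e).1 he).1) ?_ hg
  simpa only [hmem] using h

/-- Vertices of degree 2 in a minimal counterexample are not adjacent. -/
theorem not_adj_of_ncard_two (hG : MinCounter V G) {u v : V} (hu : (G.neighborSet u).ncard = 2)
    (hv : (G.neighborSet v).ncard = 2) : ¬G.Adj u v := by
  intro huv
  obtain ⟨c, hcv, hN⟩ := exists_neighbor_of_ncard_two hu huv
  obtain ⟨φ₀, h₀, -⟩ := exists_partialGood hG hu hu huv
  have huc : G.Adj u c := (hN c).2 (Or.inr rfl)
  obtain ⟨φ, h, -, hr⟩ := h₀.exists_relaxed hG.1 huc.symm (by omega)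
  have hr' := hr.ncard_le hG.1 huc.symm
  have h1 := ncard_nonzeroAt_add_one_le (φ := φ) huv.symm
  have h2 := ncard_nonzeroSide_le (φ := φ) huv.symm (m := 2)
    fun z hz _ => ncard_nonzeroAt_le hG.1 hz.symm
  rw [hv] at h1 h2
  have huc' : ∀ f ∈ nonzeroConflict G φ s(u, c),
      f ∈ nonzeroSide G φ c u ∪ nonzeroAt G φ v u ∨ f ∈ [s(u, v)] := fun f hf => by
    have := nonzeroConflict_subset_of_neighbors hN hf
    simp only [Set.mem_union, Set.mem_insert_iff, List.mem_singleton] at this ⊢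
    tauto
  have huv' : ∀ f ∈ nonzeroConflict G φ s(u, v),
      f ∈ nonzeroSide G φ v u ∪ nonzeroAt G φ c u ∨ f ∈ [s(u, c)] := fun f hf => by
    have := nonzeroConflict_subset_of_neighbors (fun x => (hN x).trans or_comm) hf
    simp only [Set.mem_union, Set.mem_insert_iff, List.mem_singleton] at this ⊢
    tauto
  have h3 := Set.ncard_union_le (nonzeroSide G φ c u) (nonzeroAt G φ v u)
  have h4 := Set.ncard_union_le (nonzeroSide G φ v u) (nonzeroAt G φ c u)
  refine hG.2.1 (h.exists_goodColoring_of_incident hN hN (l := [s(u, c), s(u, v)])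
    (by simp; tauto) ⟨(ncard_diff_le [] huc' (by simp)).trans ?_,
      (ncard_diff_le [s(u, c)] huv' (by simp)).trans ?_, trivial⟩) <;>
  simp only [List.length_cons, List.length_nil] <;> omega

/-- Completing a coloring when `u` and `v` have degree 2 and the common neighbor `a`. -/
theorem PartialGood.exists_goodColoring_of_common_neighbor (hG : Subcubic G) {u v a c d : V}
    (hu : ∀ x, G.Adj u x ↔ x = a ∨ x = c) (hv : ∀ x, G.Adj v x ↔ x = a ∨ x = d)
    (hu2 : (G.neighborSet u).ncard = 2) (hv2 : (G.neighborSet v).ncard = 2)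
    (huv : u ≠ v) (hnadj : ¬G.Adj u v) (hca : c ≠ a) (hda : d ≠ a)
    (h : PartialGood G {e | e ∈ G.edgeSet ∧ (u ∈ e ∨ v ∈ e)} φ) {A P : Set (Sym2 V)}
    (hA : A.ncard ≤ 2) (hP : P.ncard ≤ 1)
    (hau : ∀ f ∈ nonzeroSide G φ a u, f ∈ A ∨ f = s(v, a) ∨ f = s(v, d))
    (hav : ∀ f ∈ nonzeroSide G φ a v, f ∈ A ∨ f = s(u, a) ∨ f = s(u, c))
    (hau' : ∀ f ∈ nonzeroAt G φ a u, f ∈ P ∨ f = s(v, a))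
    (hav' : ∀ f ∈ nonzeroAt G φ a v, f ∈ P ∨ f = s(u, a)) :
    ∃ k, GoodColoring G k := by
  have huc : G.Adj u c := (hu c).2 (Or.inr rfl)
  have hvd : G.Adj v d := (hv d).2 (Or.inr rfl)
  obtain ⟨φ₁, h₁, hm₁, hr₁⟩ := h.exists_relaxed hG huc.symm (by omega)
  obtain ⟨φ₂, h₂, hm₂, hrd⟩ := h₁.exists_relaxed hG hvd.symm (by omega)
  have hrc := hr₁.mono hm₂
  have hm : ∀ e, φ e = 0 → φ₂ e = 0 := fun e he => hm₂ e (hm₁ e he)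
  have eC : ∀ f ∈ nonzeroConflict G φ₂ s(u, c),
      f ∈ nonzeroSide G φ₂ c u ∪ P ∨ f ∈ [s(u, a), s(v, a)] := fun f hf => by
    have h1 := nonzeroConflict_subset_of_neighbors hu hf
    have h2 := fun h => hau' f (nonzeroAt_mono hm _ _ h)
    simp only [Set.mem_union, Set.mem_insert_iff, List.mem_cons, List.not_mem_nil] at h1 ⊢
    tauto
  have eD : ∀ f ∈ nonzeroConflict G φ₂ s(v, d),
      f ∈ nonzeroSide G φ₂ d v ∪ P ∨ f ∈ [s(v, a), s(u, a)] := fun f hf => by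
    have h1 := nonzeroConflict_subset_of_neighbors hv hf
    have h2 := fun h => hav' f (nonzeroAt_mono hm _ _ h)
    simp only [Set.mem_union, Set.mem_insert_iff, List.mem_cons, List.not_mem_nil] at h1 ⊢
    tauto
  have eA : ∀ f ∈ nonzeroConflict G φ₂ s(u, a),
      f ∈ A ∪ nonzeroAt G φ₂ c u ∨ f ∈ [s(v, a), s(v, d), s(u, c)] := fun f hf => by
    have h1 := nonzeroConflict_subset_of_neighbors (fun x => (hu x).trans or_comm) hf
    have h2 := fun h => hau f (nonzeroSide_mono hm _ _ h)
    simp only [Set.mem_union, Set.mem_insert_iff, List.mem_cons, List.not_mem_nil] at h1 ⊢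
    tauto
  have eB : ∀ f ∈ nonzeroConflict G φ₂ s(v, a),
      f ∈ A ∪ nonzeroAt G φ₂ d v ∨ f ∈ [s(u, a), s(u, c), s(v, d)] := fun f hf => by
    have h1 := nonzeroConflict_subset_of_neighbors (fun x => (hv x).trans or_comm) hf
    have h2 := fun h => hav f (nonzeroSide_mono hm _ _ h)
    simp only [Set.mem_union, Set.mem_insert_iff, List.mem_cons, List.not_mem_nil] at h1 ⊢
    tauto
  have hc := hrc.ncard_le hG huc.symm
  have hd := hrd.ncard_le hG hvd.symm
  have u1 := Set.ncard_union_le (nonzeroSide G φ₂ c u) P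
  have u2 := Set.ncard_union_le (nonzeroSide G φ₂ d v) P
  have u3 := Set.ncard_union_le A (nonzeroAt G φ₂ c u)
  have u4 := Set.ncard_union_le A (nonzeroAt G φ₂ d v)
  by_cases hcd : c = d
  · subst hcd
    have z1 : φ₂ s(c, v) ≠ 0 := h₂.ne_zero_of_mem hvd.symm ⟨hvd.symm, by simp⟩
    have z2 : φ₂ s(c, u) ≠ 0 := h₂.ne_zero_of_mem huc.symm ⟨huc.symm, by simp⟩
    have m1 : s(v, c) ∈ nonzeroAt G φ₂ c u := ⟨v, hvd.symm, huv.symm, z1, Sym2.eq_swap⟩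
    have m2 : s(u, c) ∈ nonzeroAt G φ₂ c v := ⟨u, huc.symm, huv, z2, Sym2.eq_swap⟩
    have eA' : ∀ f ∈ nonzeroConflict G φ₂ s(u, a),
        f ∈ A ∪ nonzeroAt G φ₂ c u ∨ f ∈ [s(v, a), s(u, c)] := fun f hf => by
      have := eA f hf
      simp only [List.mem_cons, List.not_mem_nil, Set.mem_union] at this ⊢
      grind
    have eB' : ∀ f ∈ nonzeroConflict G φ₂ s(v, a),
        f ∈ A ∪ nonzeroAt G φ₂ c v ∨ f ∈ [s(u, a), s(v, c)] := fun f hf => by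
      have := eB f hf
      simp only [List.mem_cons, List.not_mem_nil, Set.mem_union] at this ⊢
      grind
    exact h₂.exists_goodColoring_of_incident hu hv (l := [s(u, c), s(v, c), s(v, a), s(u, a)])
      (fun e => Iff.of_eq <| by simp only [List.mem_cons, List.not_mem_nil, or_false]; ac_rfl)
      ⟨(ncard_diff_le [] eC (by simp)).trans (by simp; omega),
        (ncard_diff_le [] eD (by simp)).trans (by simp; omega),
        (ncard_diff_le [s(v, c)] eB' (by simp)).trans (by simp; omega),
        (ncard_diff_le [s(v, a), s(u, c)] eA' (by simp)).trans (by simp; omega), trivial⟩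
  by_cases hc1 : (nonzeroAt G φ₂ c u).ncard ≤ 1
  · exact h₂.exists_goodColoring_of_incident hu hv (l := [s(u, c), s(v, d), s(v, a), s(u, a)])
      (fun e => Iff.of_eq <| by simp only [List.mem_cons, List.not_mem_nil, or_false]; ac_rfl)
      ⟨(ncard_diff_le [] eC (by simp)).trans (by simp; omega),
        (ncard_diff_le [] eD (by simp)).trans (by simp; omega),
        (ncard_diff_le [s(u, c), s(v, d)] eB (by simp)).trans (by simp; omega),
        (ncard_diff_le [s(v, a), s(v, d), s(u, c)] eA (by simp)).trans (by simp; omega), trivial⟩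
  by_cases hd1 : (nonzeroAt G φ₂ d v).ncard ≤ 1
  · exact h₂.exists_goodColoring_of_incident hu hv (l := [s(u, c), s(v, d), s(u, a), s(v, a)])
      (fun e => Iff.of_eq <| by simp only [List.mem_cons, List.not_mem_nil, or_false]; ac_rfl)
      ⟨(ncard_diff_le [] eC (by simp)).trans (by simp; omega),
        (ncard_diff_le [] eD (by simp)).trans (by simp; omega),
        (ncard_diff_le [s(v, d), s(u, c)] eA (by simp)).trans (by simp; omega),
        (ncard_diff_le [s(u, a), s(u, c), s(v, d)] eB (by simp)).trans (by simp; omega), trivial⟩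
  have hncd : ¬G.Adj c d := by
    intro hadj
    have hdu : d ≠ u := by
      rintro rfl
      exact hnadj hvd.symm
    have hle := (hrc.resolve_left hc1) d hadj hdu
    have hvd0 : φ₂ s(d, v) ≠ 0 := h₂.ne_zero_of_mem hvd.symm ⟨hvd.symm, by simp⟩
    have hvc : v ≠ c := by
      rintro rfl
      exact hnadj huc
    have hmv : s(d, v) ∈ nonzeroAt G φ₂ d c := ⟨v, hvd.symm, hvc, hvd0, rfl⟩
    obtain ⟨f, ⟨z, hz, hzv, hz0, rfl⟩, hfc⟩ := Set.exists_ne_of_one_lt_ncard (not_le.1 hd1) s(d, c)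
    have hzc : z ≠ c := by
      rintro rfl
      exact hfc rfl
    have := (Set.ncard_le_one (Set.toFinite _)).1 hle _ hmv _ ⟨z, hz, hzc, hz0, rfl⟩
    exact hzv (Sym2.congr_right.1 this).symm
  have hU := incident_iff hu hv
  have hua : G.Adj u a := (hu a).2 (Or.inl rfl)
  have hva : G.Adj v a := (hv a).2 (Or.inl rfl)
  have hnuc : ¬(u = d) := by
    rintro rfl
    exact hnadj hvd.symm
  have hncv : ¬(c = v) := by
    rintro rfl
    exact hnadj huc
  have hset : {e | e ∈ G.edgeSet ∧ (u ∈ e ∨ v ∈ e)} =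
      {f | f ∈ [s(u, c), s(v, d), s(v, a), s(u, a)]} := Set.ext fun e =>
      (hU e).trans <| Iff.of_eq <| by
        simp only [Set.mem_ofPred_eq, List.mem_cons, List.not_mem_nil, or_false]
        ac_rfl
  rw [hset] at h₂
  have a1 := le_ncard_available <|
    ncard_diff_le (l := [s(u, c), s(v, d), s(v, a), s(u, a)]) [] eC (by simp)
  have a2 := le_ncard_available <|
    ncard_diff_le (l := [s(u, c), s(v, d), s(v, a), s(u, a)]) [] eD (by simp)
  have a3 := le_ncard_available <|
    ncard_diff_le (l := [s(u, c), s(v, d), s(v, a), s(u, a)]) [] eB (by simp)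
  have a4 := le_ncard_available <|
    ncard_diff_le (l := [s(u, c), s(v, d), s(v, a), s(u, a)]) [] eA (by simp)
  simp only [List.length_nil] at a1 a2 a3 a4
  refine PartialGood.exists_goodColoring_of_representatives (e₁ := s(u, c)) (e₂ := s(v, d))
    (e₃ := s(v, a)) (e₄ := s(u, a)) (U := {f | f ∈ [s(u, c), s(v, d), s(v, a), s(u, a)]})
    ?_ ?_ (fun e => Iff.rfl) h₂ ?_ (by omega) (by omega) (by omega) (by omega)
  · simp [huc, hvd, hva, hua]
  · simp [huv, hca, hda, hnuc, hncv, hcd, huv.symm, hua.ne, hva.ne]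
  · rintro ⟨-, x, hx, y, hy, hxy⟩
    have n1 : ¬G.Adj u d := fun h => by
      rcases (hu d).1 h with h | h
      exacts [hda h, hcd h.symm]
    have n2 : ¬G.Adj c v := fun h => by
      rcases (hv c).1 h.symm with h | h
      exacts [hca h, hcd h]
    rcases Sym2.mem_iff.1 hx with rfl | rfl <;> rcases Sym2.mem_iff.1 hy with rfl | rfl <;> tauto

theorem ncard_eq_three_of_adj (hG : MinCounter V G) {u a b : V}
    (hu : (G.neighborSet u).ncard = 2) (hau : G.Adj a u) (hab : G.Adj a b) (hub : u ≠ b) :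
    (G.neighborSet a).ncard = 3 := by
  have h1 : (G.neighborSet a).ncard ≠ 2 := fun h => not_adj_of_ncard_two hG h hu hau
  have h2 := hG.1 a
  have h3 : {u, b} ⊆ G.neighborSet a := by
    rintro x (rfl | rfl)
    exacts [hau, hab]
  have h4 := Set.ncard_le_ncard h3
  rw [Set.ncard_pair hub] at h4
  omega

/-- Distinct vertices of degree 2 in a minimal counterexample have no common neighbor. -/
theorem not_adj_and_adj_of_ncard_two (hG : MinCounter V G) {u v : V} (huv : u ≠ v)
    (hu2 : (G.neighborSet u).ncard = 2) (hv2 : (G.neighborSet v).ncard = 2) (a : V) :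
    ¬(G.Adj u a ∧ G.Adj v a) := by
  rintro ⟨hua, hva⟩
  obtain ⟨c, hca, hu⟩ := exists_neighbor_of_ncard_two hu2 hua
  obtain ⟨d, hda, hv⟩ := exists_neighbor_of_ncard_two hv2 hva
  have hnadj := not_adj_of_ncard_two hG hu2 hv2
  have ha3 := ncard_eq_three_of_adj hG hu2 hua.symm hva.symm huv
  obtain ⟨a', ha'u, ha'v, ha⟩ := exists_neighbor_of_ncard_three ha3 hua.symm hva.symm huv
  have ha' : ∀ x, G.Adj a x ↔ x = v ∨ x = u ∨ x = a' := fun x => (ha x).trans (by tauto)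
  have haa' : G.Adj a a' := (ha a').2 (by simp)
  obtain ⟨φ, h, h0⟩ := exists_partialGood hG hu2 hv2 hua
  have ha0 := h0 u (Or.inl rfl) a hua
  have key : ∀ (ψ : Sym2 V → Fin 8) (P : Set (Sym2 V)),
      PartialGood G {e | e ∈ G.edgeSet ∧ (u ∈ e ∨ v ∈ e)} ψ → P.ncard ≤ 1 →
      (P ∪ nonzeroAt G ψ a' a).ncard ≤ 2 → (ψ s(a, a') ≠ 0 → s(a, a') ∈ P) →
      ∃ k, GoodColoring G k := by
    intro ψ P hψ hP hA hψ0
    refine hψ.exists_goodColoring_of_common_neighbor hG.1 hu hv hu2 hv2 huv hnadj hca hda hA hP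
      (fun f hf => ?_) (fun f hf => ?_) (fun f hf => ?_) (fun f hf => ?_)
    · rcases mem_nonzeroSide_cases ha hf with hf | hf | hf
      · have := eq_or_eq_of_mem_nonzeroAt ha hf
        have := Sym2.eq_swap (a := a) (b := v)
        grind
      · have := nonzeroAt_subset_of_two hv hf
        simp_all
      · exact Or.inl (Or.inr hf)
    · rcases mem_nonzeroSide_cases ha' hf with hf | hf | hf
      · have := eq_or_eq_of_mem_nonzeroAt ha' hf
        have := Sym2.eq_swap (a := a) (b := u)
        grind
      · have := nonzeroAt_subset_of_two hu hf
        simp_all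
      · exact Or.inl (Or.inr hf)
    · have := eq_or_eq_of_mem_nonzeroAt ha hf
      have := Sym2.eq_swap (a := a) (b := v)
      grind
    · have := eq_or_eq_of_mem_nonzeroAt ha' hf
      have := Sym2.eq_swap (a := a) (b := u)
      grind
  refine hG.2.1 ?_
  by_cases hle : (nonzeroAt G φ a' a).ncard ≤ 1
  · refine key φ {s(a, a')} h (by simp) ((Set.ncard_union_le _ _).trans ?_) (by simp)
    simp only [Set.ncard_singleton]
    omega
  · obtain ⟨h3, hz⟩ := free_of_two_le hG.1 haa'.symm (not_le.1 hle)
    obtain ⟨ψ, hψ, hψ0, -⟩ := h.recolor haa' ha3 h3 ha0 fun z hz' => by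
      by_cases hza : z = a
      · rw [hza, Sym2.eq_swap]
        exact ha0 a' haa'
      · exact hz z hz' hza
    exact key ψ ∅ hψ (by simp) (by simpa using ncard_nonzeroAt_le hG.1 haa'.symm)
      fun h => absurd hψ0 h

/-- Completing a coloring when `u` and `v` have degree 2, with neighbors `a` and `b`. -/
theorem PartialGood.exists_goodColoring_of_path (hG : Subcubic G) {u v a b c d : V}
    (hu : ∀ x, G.Adj u x ↔ x = a ∨ x = c) (hv : ∀ x, G.Adj v x ↔ x = b ∨ x = d)
    (hu2 : (G.neighborSet u).ncard = 2) (hv2 : (G.neighborSet v).ncard = 2)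
    (h : PartialGood G {e | e ∈ G.edgeSet ∧ (u ∈ e ∨ v ∈ e)} φ) {A B : Set (Sym2 V)}
    {p q : Sym2 V} (hA : A.ncard ≤ 3) (hB : B.ncard ≤ 4)
    (hau : ∀ f ∈ nonzeroSide G φ a u, f ∈ A ∨ f = s(v, b))
    (hbv : ∀ f ∈ nonzeroSide G φ b v, f ∈ B ∨ f = s(u, a))
    (hau' : ∀ f ∈ nonzeroAt G φ a u, f = p) (hbv' : ∀ f ∈ nonzeroAt G φ b v, f = q) :
    ∃ k, GoodColoring G k := by
  have huc : G.Adj u c := (hu c).2 (Or.inr rfl)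
  have hvd : G.Adj v d := (hv d).2 (Or.inr rfl)
  obtain ⟨φ₁, h₁, hm₁, hr₁⟩ := h.exists_relaxed hG huc.symm (by omega)
  obtain ⟨φ₂, h₂, hm₂, hrd⟩ := h₁.exists_relaxed hG hvd.symm (by omega)
  have hm : ∀ e, φ e = 0 → φ₂ e = 0 := fun e he => hm₂ e (hm₁ e he)
  have eC : ∀ f ∈ nonzeroConflict G φ₂ s(u, c),
      f ∈ nonzeroSide G φ₂ c u ∨ f ∈ [s(u, a), p] := fun f hf => by
    have h1 := nonzeroConflict_subset_of_neighbors hu hf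
    have h2 := fun h => hau' f (nonzeroAt_mono hm _ _ h)
    simp only [Set.mem_union, Set.mem_insert_iff, List.mem_cons, List.not_mem_nil] at h1 ⊢
    tauto
  have eD : ∀ f ∈ nonzeroConflict G φ₂ s(v, d),
      f ∈ nonzeroSide G φ₂ d v ∨ f ∈ [s(v, b), q] := fun f hf => by
    have h1 := nonzeroConflict_subset_of_neighbors hv hf
    have h2 := fun h => hbv' f (nonzeroAt_mono hm _ _ h)
    simp only [Set.mem_union, Set.mem_insert_iff, List.mem_cons, List.not_mem_nil] at h1 ⊢
    tauto
  have eA : ∀ f ∈ nonzeroConflict G φ₂ s(u, a),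
      f ∈ A ∪ nonzeroAt G φ₂ c u ∨ f ∈ [s(v, b), s(u, c)] := fun f hf => by
    have h1 := nonzeroConflict_subset_of_neighbors (fun x => (hu x).trans or_comm) hf
    have h2 := fun h => hau f (nonzeroSide_mono hm _ _ h)
    simp only [Set.mem_union, Set.mem_insert_iff, List.mem_cons, List.not_mem_nil] at h1 ⊢
    tauto
  have eB : ∀ f ∈ nonzeroConflict G φ₂ s(v, b),
      f ∈ B ∪ nonzeroAt G φ₂ d v ∨ f ∈ [s(u, a), s(v, d)] := fun f hf => by
    have h1 := nonzeroConflict_subset_of_neighbors (fun x => (hv x).trans or_comm) hf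
    have h2 := fun h => hbv f (nonzeroSide_mono hm _ _ h)
    simp only [Set.mem_union, Set.mem_insert_iff, List.mem_cons, List.not_mem_nil] at h1 ⊢
    tauto
  have hc := (hr₁.mono hm₂).ncard_le hG huc.symm
  have hd := hrd.ncard_le hG hvd.symm
  have u1 := Set.ncard_union_le A (nonzeroAt G φ₂ c u)
  have u2 := Set.ncard_union_le B (nonzeroAt G φ₂ d v)
  rcases hc with ⟨c1, c2⟩ | ⟨c1, c2⟩ <;> rcases hd with ⟨d1, d2⟩ | ⟨d1, d2⟩
  · exact h₂.exists_goodColoring_of_incident hu hv (l := [s(u, c), s(v, d), s(v, b), s(u, a)])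
      (fun e => Iff.of_eq <| by simp only [List.mem_cons, List.not_mem_nil, or_false]; ac_rfl)
      ⟨(ncard_diff_le [p] eC (by simp)).trans (by simp; omega),
        (ncard_diff_le [q] eD (by simp)).trans (by simp; omega),
        (ncard_diff_le [s(v, d)] eB (by simp)).trans (by simp; omega),
        (ncard_diff_le [s(v, b), s(u, c)] eA (by simp)).trans (by simp; omega), trivial⟩
  · exact h₂.exists_goodColoring_of_incident hu hv (l := [s(v, b), s(u, c), s(u, a), s(v, d)])
      (fun e => Iff.of_eq <| by simp only [List.mem_cons, List.not_mem_nil, or_false]; ac_rfl)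
      ⟨(ncard_diff_le [] eB (by simp)).trans (by simp; omega),
        (ncard_diff_le [p] eC (by simp)).trans (by simp; omega),
        (ncard_diff_le [s(v, b), s(u, c)] eA (by simp)).trans (by simp; omega),
        (ncard_diff_le [s(v, b), q] eD (by simp)).trans (by simp; omega), trivial⟩
  · exact h₂.exists_goodColoring_of_incident hu hv (l := [s(v, d), s(v, b), s(u, a), s(u, c)])
      (fun e => Iff.of_eq <| by simp only [List.mem_cons, List.not_mem_nil, or_false]; ac_rfl)
      ⟨(ncard_diff_le [q] eD (by simp)).trans (by simp; omega),
        (ncard_diff_le [s(v, d)] eB (by simp)).trans (by simp; omega),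
        (ncard_diff_le [s(v, b)] eA (by simp)).trans (by simp; omega),
        (ncard_diff_le [s(u, a), p] eC (by simp)).trans (by simp; omega), trivial⟩
  · exact h₂.exists_goodColoring_of_incident hu hv (l := [s(v, b), s(u, a), s(u, c), s(v, d)])
      (fun e => Iff.of_eq <| by simp only [List.mem_cons, List.not_mem_nil, or_false]; ac_rfl)
      ⟨(ncard_diff_le [] eB (by simp)).trans (by simp; omega),
        (ncard_diff_le [s(v, b)] eA (by simp)).trans (by simp; omega),
        (ncard_diff_le [s(u, a), p] eC (by simp)).trans (by simp; omega),
        (ncard_diff_le [s(v, b), q] eD (by simp)).trans (by simp; omega), trivial⟩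

/-- Vertices of degree 2 in a minimal counterexample are not joined by a walk of length 3. -/
theorem not_path_of_ncard_two (hG : MinCounter V G) {u v : V}
    (hu2 : (G.neighborSet u).ncard = 2) (hv2 : (G.neighborSet v).ncard = 2) (a b : V) :
    ¬(G.Adj u a ∧ G.Adj a b ∧ G.Adj v b) := by
  rintro ⟨hua, hab, hvb⟩
  have hnadj := not_adj_of_ncard_two hG hu2 hv2
  have hub : u ≠ b := by
    rintro rfl
    exact hnadj hvb.symm
  have hva : v ≠ a := by
    rintro rfl
    exact hnadj hua
  obtain ⟨c, -, hu⟩ := exists_neighbor_of_ncard_two hu2 hua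
  obtain ⟨d, -, hv⟩ := exists_neighbor_of_ncard_two hv2 hvb
  have ha3 := ncard_eq_three_of_adj hG hu2 hua.symm hab hub
  have hb3 := ncard_eq_three_of_adj hG hv2 hvb.symm hab.symm hva
  obtain ⟨a', ha'u, ha'b, ha⟩ := exists_neighbor_of_ncard_three ha3 hua.symm hab hub
  obtain ⟨b', hb'v, hb'a, hb⟩ := exists_neighbor_of_ncard_three hb3 hvb.symm hab.symm hva
  have haa' : G.Adj a a' := (ha a').2 (by simp)
  have hbb' : G.Adj b b' := (hb b').2 (by simp)
  have ha₂ : ∀ x, G.Adj a x ↔ x = b ∨ x = u ∨ x = a' := fun x => (ha x).trans (by tauto)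
  have hb₂ : ∀ x, G.Adj b x ↔ x = a ∨ x = v ∨ x = b' := fun x => (hb x).trans (by tauto)
  obtain ⟨φ, h, h0⟩ := exists_partialGood hG hu2 hv2 hua
  have ha0 := h0 u (Or.inl rfl) a hua
  have hb0 := h0 v (Or.inr rfl) b hvb
  have sab := Sym2.eq_swap (a := a) (b := b)
  have sau := Sym2.eq_swap (a := a) (b := u)
  have sbv := Sym2.eq_swap (a := b) (b := v)
  have la := ncard_nonzeroAt_le (φ := φ) hG.1 haa'.symm
  have lb := ncard_nonzeroAt_le (φ := φ) hG.1 hbb'.symm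
  refine hG.2.1 ?_
  by_cases hle : (({s(a, a'), s(b, b')} : Set (Sym2 V)) ∪ nonzeroAt G φ a' a).ncard ≤ 3 ∨
      (({s(a, a'), s(b, b')} : Set (Sym2 V)) ∪ nonzeroAt G φ b' b).ncard ≤ 3
  · obtain ⟨ψ, hψ, hψ0, hext⟩ := h.recolor hab ha3 hb3 ha0 hb0
    have hm : ∀ e, φ e = 0 → ψ e = 0 := fun e he => by
      by_cases hab' : e = s(a, b)
      · rw [hab', hψ0]
      · rw [hext e hab', he]
    have e1 : ∀ f ∈ nonzeroAt G ψ a u, f = s(a, a') := fun f hf => by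
      have := eq_or_eq_of_mem_nonzeroAt ha hf
      grind
    have e2 : ∀ f ∈ nonzeroAt G ψ b v, f = s(b, b') := fun f hf => by
      have := eq_or_eq_of_mem_nonzeroAt hb hf
      grind
    have e3 : ∀ f ∈ nonzeroSide G ψ a u,
        f ∈ ({s(a, a'), s(b, b')} : Set (Sym2 V)) ∪ nonzeroAt G φ a' a ∨ f = s(v, b) :=
      fun f hf => by
        rcases mem_nonzeroSide_cases ha hf with hf | hf | hf
        · have := e1 f hf
          simp [this]
        · have := (eq_or_eq_of_mem_nonzeroAt hb₂ hf).1
          simp only [Set.mem_union, Set.mem_insert_iff, Set.mem_singleton_iff]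
          grind
        · exact Or.inl (Or.inr (nonzeroAt_mono hm _ _ hf))
    have e4 : ∀ f ∈ nonzeroSide G ψ b v,
        f ∈ ({s(a, a'), s(b, b')} : Set (Sym2 V)) ∪ nonzeroAt G φ b' b ∨ f = s(u, a) :=
      fun f hf => by
        rcases mem_nonzeroSide_cases hb hf with hf | hf | hf
        · have := e2 f hf
          simp [this]
        · have := (eq_or_eq_of_mem_nonzeroAt ha₂ hf).1
          simp only [Set.mem_union, Set.mem_insert_iff, Set.mem_singleton_iff]
          grind
        · exact Or.inl (Or.inr (nonzeroAt_mono hm _ _ hf))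
    have u1 := Set.ncard_union_le {s(a, a'), s(b, b')} (nonzeroAt G φ a' a)
    have u2 := Set.ncard_union_le {s(a, a'), s(b, b')} (nonzeroAt G φ b' b)
    have u3 := Set.ncard_insert_le s(a, a') {s(b, b')}
    rw [Set.ncard_singleton] at u3
    rcases hle with hle | hle
    · exact hψ.exists_goodColoring_of_path hG.1 hu hv hu2 hv2 hle (by omega) e3 e4 e1 e2
    · have hset : {e | e ∈ G.edgeSet ∧ (u ∈ e ∨ v ∈ e)} =
          {e | e ∈ G.edgeSet ∧ (v ∈ e ∨ u ∈ e)} := Set.ext fun e => and_congr_right' or_comm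
      rw [hset] at hψ
      exact hψ.exists_goodColoring_of_path hG.1 hv hu hv2 hu2 hle (by omega) e4 e3 e2 e1
  · obtain ⟨n1, n2⟩ := not_or.1 hle
    have u1 := Set.ncard_union_le {s(a, a'), s(b, b')} (nonzeroAt G φ a' a)
    have u2 := Set.ncard_union_le {s(a, a'), s(b, b')} (nonzeroAt G φ b' b)
    have u3 := Set.ncard_insert_le s(a, a') {s(b, b')}
    rw [Set.ncard_singleton] at u3
    have hab' : a' ≠ b' := by
      rintro rfl
      refine n1 ((Set.ncard_le_ncard (t := insert s(a, a') (nonzeroAt G φ a' a)) ?_).trans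
        ((Set.ncard_insert_le _ _).trans (by omega)))
      have : s(b, a') ∈ nonzeroAt G φ a' a :=
        ⟨b, hbb'.symm, hab.ne', by
          rw [Sym2.eq_swap]
          exact hb0 a' hbb', Sym2.eq_swap⟩
      rintro f ((rfl | rfl) | hf)
      exacts [Or.inl rfl, Or.inr this, Or.inr hf]
    obtain ⟨a3, az⟩ := free_of_two_le (φ := φ) hG.1 haa'.symm (by omega)
    obtain ⟨b3, bz⟩ := free_of_two_le (φ := φ) hG.1 hbb'.symm (by omega)
    have az' : ∀ z, G.Adj a' z → φ s(a', z) ≠ 0 := fun z hz => by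
      by_cases hza : z = a
      · rw [hza, Sym2.eq_swap]
        exact ha0 a' haa'
      · exact az z hz hza
    have bz' : ∀ z, G.Adj b' z → φ s(b', z) ≠ 0 := fun z hz => by
      by_cases hzb : z = b
      · rw [hzb, Sym2.eq_swap]
        exact hb0 b' hbb'
      · exact bz z hz hzb
    obtain ⟨φ₁, h₁, h₁0, hext₁⟩ := h.recolor haa' ha3 a3 ha0 az'
    have hne : ∀ x z, x ≠ a → x ≠ a' → s(x, z) ≠ s(a, a') := fun x z h1 h2 he => by
      have := Sym2.mem_iff.1 (he ▸ Sym2.mem_mk_left x z)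
      tauto
    obtain ⟨ψ, hψ, hψ0, hext₂⟩ := h₁.recolor hbb' hb3 b3
      (fun z hz => by
        rw [hext₁ _ (hne b z hab.ne' ha'b.symm)]
        exact hb0 z hz)
      (fun z hz => by
        rw [hext₁ _ (hne b' z hb'a hab'.symm)]
        exact bz' z hz)
    have hψa : ψ s(a, a') = 0 := by
      by_cases he : s(a, a') = s(b, b')
      · rw [he, hψ0]
      · rw [hext₂ _ he, h₁0]
    have e1 : ∀ f ∈ nonzeroAt G ψ a u, f = s(a, b) := fun f hf => by
      have := eq_or_eq_of_mem_nonzeroAt ha hf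
      grind
    have e2 : ∀ f ∈ nonzeroAt G ψ b v, f = s(a, b) := fun f hf => by
      have := eq_or_eq_of_mem_nonzeroAt hb hf
      grind
    have la' := ncard_nonzeroAt_le (φ := ψ) hG.1 haa'.symm
    have lb' := ncard_nonzeroAt_le (φ := ψ) hG.1 hbb'.symm
    have i1 := Set.ncard_insert_le s(a, b) (nonzeroAt G ψ a' a)
    have i2 := Set.ncard_insert_le s(a, b) (nonzeroAt G ψ b' b)
    refine hψ.exists_goodColoring_of_path hG.1 hu hv hu2 hv2
      (A := insert s(a, b) (nonzeroAt G ψ a' a)) (B := insert s(a, b) (nonzeroAt G ψ b' b))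
      (by omega) (by omega) (fun f hf => ?_) (fun f hf => ?_) e1 e2
    · rcases mem_nonzeroSide_cases ha hf with hf | hf | hf
      · exact Or.inl (Or.inl (e1 f hf))
      · have := eq_or_eq_of_mem_nonzeroAt hb₂ hf
        grind
      · exact Or.inl (Or.inr hf)
    · rcases mem_nonzeroSide_cases hb hf with hf | hf | hf
      · exact Or.inl (Or.inl (e2 f hf))
      · have := eq_or_eq_of_mem_nonzeroAt ha₂ hf
        grind
      · exact Or.inl (Or.inr hf)

end Finite

end PackingEC

/-- In a minimal counterexample, any two distinct vertices of degree 2 are at distance at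
least 4: every walk joining them has length at least 4. -/
theorem minCounter_deg2_far_apart {V : Type} [Finite V] (G : SimpleGraph V)
    (hG : MinCounter V G) :
    ∀ u v : V, u ≠ v → (G.neighborSet u).ncard = 2 → (G.neighborSet v).ncard = 2 →
      ∀ w : G.Walk u v, 4 ≤ w.length := by
  intro u v huv hu hv w
  by_contra hw
  match w, hw with
  | .nil, _ => exact huv rfl
  | .cons h₁ .nil, _ => exact PackingEC.not_adj_of_ncard_two hG hu hv h₁
  | .cons h₁ (.cons h₂ .nil), _ =>
    exact PackingEC.not_adj_and_adj_of_ncard_two hG huv hu hv _ ⟨h₁, h₂.symm⟩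
  | .cons h₁ (.cons h₂ (.cons h₃ .nil)), _ =>
    exact PackingEC.not_path_of_ncard_two hG hu hv _ _ ⟨h₁, h₂, h₃.symm⟩
  | .cons _ (.cons _ (.cons _ (.cons _ p))), hw =>
    simp only [Walk.length_cons] at hw
    omega
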